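/- Let α, β be real numbers with α > 0, β > 0 and α + β < 1, and set a = (2/β)·√(α(1−α−β)) and γ = (1−α−β)/α. Define K: ℕ × ℕ → ℝ by K(x,t) = β^t · ( γ^{−x/2} · I_x^{a}(t) + ((2α+β−1)/α) · Σ_{j=1}^{⌊(t−x)/2⌋} γ^{−(x+2j)/2} · I_{x+2j}^{a}(t) ). Then K(0,0)=1 and K(x,0)=0 for x ≥ 1; K(0,t+1) − K(0,t) = (β−1)·K(0,t) + (1−β)·K(1,t) for all t ≥ 0; and K(x,t+1) − K(x,t) = (β−1)·K(x,t) + (1−β−α)·K(x+1,t) + α·K(x−1,t) for all x ≥ 1 and t ≥ 0. -/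

import Mathlib

open Finset

/-- The discrete `I`-Bessel function `I_n^c(t)` (real parameter `c`). -/
noncomputable def besselI (c : ℝ) (n t : ℕ) : ℝ :=
  if n ≤ t then
    ∑ j ∈ Finset.range ((t - n) / 2 + 1),
      (t.factorial : ℝ) /
          ((j.factorial : ℝ) * ((t - 2 * j - n).factorial : ℝ) * ((n + j).factorial : ℝ)) *
        (c / 2) ^ (2 * j + n)
  else 0

/-- The kernel `K(x,t) = β^t (γ^{-x/2} I_x^a(t) +
((2α+β-1)/α) Σ_{j=1}^{⌊(t-x)/2⌋} γ^{-(x+2j)/2} I_{x+2j}^a(t))`,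
with `a = (2/β)√(α(1-α-β))` and `γ = (1-α-β)/α`. -/
noncomputable def Kab (α β : ℝ) (x t : ℕ) : ℝ :=
  β ^ t *
    ((Real.sqrt ((1 - α - β) / α) ^ x)⁻¹ *
        besselI (2 / β * Real.sqrt (α * (1 - α - β))) x t +
      (2 * α + β - 1) / α * ∑ j ∈ Finset.Icc 1 ((t - x) / 2),
        (Real.sqrt ((1 - α - β) / α) ^ (x + 2 * j))⁻¹ *
          besselI (2 / β * Real.sqrt (α * (1 - α - β))) (x + 2 * j) t)

lemma besselI_eq_sum_choose (c : ℝ) (n t N : ℕ) (hN : t ≤ N) :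
    besselI c n t = ∑ j ∈ range (N + 1),
      (t.choose (n + 2 * j) : ℝ) * ((n + 2 * j).choose j : ℝ) * (c / 2) ^ (n + 2 * j) := by
  unfold besselI
  split_ifs with h
  · have hsub : range ((t - n) / 2 + 1) ⊆ range (N + 1) := by
      intro j hj
      simp only [mem_range] at *
      omega
    rw [← sum_subset hsub]
    · refine sum_congr rfl fun j hj => ?_
      have hj' : n + 2 * j ≤ t := by
        simp only [mem_range] at hj
        omega
      rw [Nat.cast_choose ℝ hj', Nat.cast_choose ℝ (by omega : j ≤ n + 2 * j),
        show t - 2 * j - n = t - (n + 2 * j) by omega,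
        show n + 2 * j - j = n + j by omega, add_comm (2 * j) n]
      have h₁ : ((n + 2 * j).factorial : ℝ) ≠ 0 := by positivity
      field_simp
    · intro j _ hj
      have hj' : t < n + 2 * j := by
        simp only [mem_range] at hj
        omega
      simp [Nat.choose_eq_zero_of_lt hj']
  · symm
    refine sum_eq_zero fun j _ => ?_
    simp [Nat.choose_eq_zero_of_lt (by omega : t < n + 2 * j)]

lemma besselI_of_lt (c : ℝ) {n t : ℕ} (h : t < n) : besselI c n t = 0 := by
  simp [besselI, not_le.mpr h]

lemma besselI_zero_zero (c : ℝ) : besselI c 0 0 = 1 := by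
  simp [besselI]

lemma besselI_succ_succ (c : ℝ) (n t : ℕ) :
    besselI c (n + 1) (t + 1) =
      besselI c (n + 1) t + c / 2 * (besselI c n t + besselI c (n + 2) t) := by
  rw [besselI_eq_sum_choose c (n + 1) (t + 1) (t + 1) le_rfl,
    besselI_eq_sum_choose c (n + 1) t (t + 1) (by omega),
    besselI_eq_sum_choose c n t (t + 1) (by omega),
    besselI_eq_sum_choose c (n + 2) t t le_rfl,
    sum_range_succ' _ (t + 1), sum_range_succ' _ (t + 1), sum_range_succ' _ (t + 1)]
  have hterm : ∀ j : ℕ,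
      ((t + 1).choose (n + 1 + 2 * (j + 1)) : ℝ) * ((n + 1 + 2 * (j + 1)).choose (j + 1) : ℝ) *
          (c / 2) ^ (n + 1 + 2 * (j + 1)) =
        (t.choose (n + 1 + 2 * (j + 1)) : ℝ) * ((n + 1 + 2 * (j + 1)).choose (j + 1) : ℝ) *
          (c / 2) ^ (n + 1 + 2 * (j + 1)) +
        (c / 2 * ((t.choose (n + 2 * (j + 1)) : ℝ) * ((n + 2 * (j + 1)).choose (j + 1) : ℝ) *
          (c / 2) ^ (n + 2 * (j + 1))) +
        c / 2 * ((t.choose (n + 2 + 2 * j) : ℝ) * ((n + 2 + 2 * j).choose j : ℝ) *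
          (c / 2) ^ (n + 2 + 2 * j))) := by
    intro j
    rw [show n + 1 + 2 * (j + 1) = (n + 2 + 2 * j) + 1 by ring,
      show n + 2 * (j + 1) = n + 2 + 2 * j by ring,
      Nat.choose_succ_succ t, Nat.choose_succ_succ (n + 2 + 2 * j)]
    push_cast
    ring
  simp only [hterm, sum_add_distrib, ← mul_sum, Nat.choose_succ_succ t, mul_zero, add_zero,
    Nat.choose_zero_right]
  push_cast
  ring

lemma besselI_zero_succ (c : ℝ) (t : ℕ) :
    besselI c 0 (t + 1) = besselI c 0 t + c * besselI c 1 t := by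
  rw [besselI_eq_sum_choose c 0 (t + 1) (t + 1) le_rfl,
    besselI_eq_sum_choose c 0 t (t + 1) (by omega),
    besselI_eq_sum_choose c 1 t t le_rfl,
    sum_range_succ' _ (t + 1), sum_range_succ' _ (t + 1)]
  have hterm : ∀ j : ℕ,
      ((t + 1).choose (0 + 2 * (j + 1)) : ℝ) * ((0 + 2 * (j + 1)).choose (j + 1) : ℝ) *
          (c / 2) ^ (0 + 2 * (j + 1)) =
        (t.choose (0 + 2 * (j + 1)) : ℝ) * ((0 + 2 * (j + 1)).choose (j + 1) : ℝ) *
          (c / 2) ^ (0 + 2 * (j + 1)) +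
        c * ((t.choose (1 + 2 * j) : ℝ) * ((1 + 2 * j).choose j : ℝ) *
          (c / 2) ^ (1 + 2 * j)) := by
    intro j
    have hsymm : (1 + 2 * j).choose (j + 1) = (1 + 2 * j).choose j :=
      Nat.choose_symm_of_eq_add (by ring)
    rw [show 0 + 2 * (j + 1) = (1 + 2 * j) + 1 by ring,
      Nat.choose_succ_succ t, Nat.choose_succ_succ (1 + 2 * j), hsymm]
    push_cast
    ring
  simp only [hterm, sum_add_distrib, ← mul_sum, mul_zero, add_zero, Nat.choose_zero_right]
  ring

/-- The rescaled Bessel function `β^t γ^{-n/2} I_n^a(t)` from which `Kab` is built. -/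
noncomputable def scaledBessel (α β : ℝ) (n t : ℕ) : ℝ :=
  β ^ t * ((Real.sqrt ((1 - α - β) / α) ^ n)⁻¹ *
    besselI (2 / β * Real.sqrt (α * (1 - α - β))) n t)

lemma Kab_eq_sum_scaledBessel (α β : ℝ) (x t N : ℕ) (hN : t ≤ N) :
    Kab α β x t = scaledBessel α β x t +
      (2 * α + β - 1) / α * ∑ j ∈ range N, scaledBessel α β (x + 2 * j + 2) t := by
  have hsub : range ((t - x) / 2) ⊆ range N := by
    intro j hj
    simp only [mem_range] at *
    omega
  rw [← sum_subset hsub]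
  · unfold Kab scaledBessel
    rw [← mul_sum, ← Finset.Ico_add_one_right_eq_Icc, Finset.sum_Ico_eq_sum_range,
      Nat.add_sub_cancel]
    simp only [show ∀ j, x + 2 * (1 + j) = x + 2 * j + 2 from fun j => by ring]
    ring
  · intro j _ hj
    have : t < x + 2 * j + 2 := by
      simp only [mem_range] at hj
      omega
    simp [scaledBessel, besselI_of_lt _ this]

lemma sqrt_mul_eq_mul_sqrt_div {α p : ℝ} (hα : 0 < α) :
    Real.sqrt (α * p) = α * Real.sqrt (p / α) := by
  rw [show α * p = α ^ 2 * (p / α) by field_simp, Real.sqrt_mul (by positivity),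
    Real.sqrt_sq hα.le]

lemma scaledBessel_succ_succ {α β : ℝ} (hα : 0 < α) (hβ : 0 < β) (hαβ : α + β < 1)
    (n t : ℕ) :
    scaledBessel α β (n + 1) (t + 1) = β * scaledBessel α β (n + 1) t +
      α * scaledBessel α β n t + (1 - α - β) * scaledBessel α β (n + 2) t := by
  have hγ : 0 < (1 - α - β) / α := div_pos (by linarith) hα
  have hs := Real.sqrt_pos.mpr hγ
  have hp : 1 - α - β = α * Real.sqrt ((1 - α - β) / α) ^ 2 := by
    rw [Real.sq_sqrt hγ.le]
    field_simp
  unfold scaledBessel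
  rw [besselI_succ_succ, sqrt_mul_eq_mul_sqrt_div hα]
  generalize Real.sqrt ((1 - α - β) / α) = s at *
  rw [hp]
  field_simp
  ring

lemma scaledBessel_zero_succ {α β : ℝ} (hα : 0 < α) (hβ : 0 < β) (hαβ : α + β < 1)
    (t : ℕ) :
    scaledBessel α β 0 (t + 1) =
      β * scaledBessel α β 0 t + 2 * (1 - α - β) * scaledBessel α β 1 t := by
  have hγ : 0 < (1 - α - β) / α := div_pos (by linarith) hα
  have hs := Real.sqrt_pos.mpr hγ
  have hp : 1 - α - β = α * Real.sqrt ((1 - α - β) / α) ^ 2 := by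
    rw [Real.sq_sqrt hγ.le]
    field_simp
  unfold scaledBessel
  rw [besselI_zero_succ, sqrt_mul_eq_mul_sqrt_div hα]
  generalize Real.sqrt ((1 - α - β) / α) = s at *
  rw [hp]
  field_simp
  ring

theorem stmt19 (α β : ℝ) (hα : 0 < α) (hβ : 0 < β) (hαβ : α + β < 1) :
    (Kab α β 0 0 = 1 ∧ ∀ x : ℕ, 1 ≤ x → Kab α β x 0 = 0) ∧
    (∀ t : ℕ, Kab α β 0 (t + 1) - Kab α β 0 t =
      (β - 1) * Kab α β 0 t + (1 - β) * Kab α β 1 t) ∧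
    (∀ x t : ℕ, 1 ≤ x → Kab α β x (t + 1) - Kab α β x t =
      (β - 1) * Kab α β x t + (1 - β - α) * Kab α β (x + 1) t + α * Kab α β (x - 1) t) := by
  refine ⟨⟨?_, ?_⟩, ?_, ?_⟩
  · simp [Kab, besselI_zero_zero]
  · intro x hx
    simp [Kab, besselI_of_lt _ hx]
  · intro t
    have hvanish : scaledBessel α β (0 + 2 * (t + 1) + 1) t = 0 := by
      rw [scaledBessel, besselI_of_lt _ (by omega), mul_zero, mul_zero]
    have htel : ∑ j ∈ range (t + 1), scaledBessel α β (0 + 2 * j + 1) t =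
        scaledBessel α β 1 t + ∑ j ∈ range (t + 1), scaledBessel α β (1 + 2 * j + 2) t := by
      have h := sum_range_succ (fun j => scaledBessel α β (0 + 2 * j + 1) t) (t + 1)
      rw [sum_range_succ', hvanish, add_zero] at h
      rw [← h, add_comm]
      congr 1
      exact sum_congr rfl fun j _ => by congr 1; ring
    have hshift : ∑ j ∈ range (t + 1), scaledBessel α β (0 + 2 * j + 1 + 2) t =
        ∑ j ∈ range (t + 1), scaledBessel α β (1 + 2 * j + 2) t :=
      sum_congr rfl fun j _ => by congr 1; ring
    rw [Kab_eq_sum_scaledBessel α β 0 (t + 1) (t + 1) le_rfl,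
      Kab_eq_sum_scaledBessel α β 0 t (t + 1) (by omega),
      Kab_eq_sum_scaledBessel α β 1 t (t + 1) (by omega),
      scaledBessel_zero_succ hα hβ hαβ]
    simp only [scaledBessel_succ_succ hα hβ hαβ, sum_add_distrib, ← mul_sum]
    rw [htel, hshift]
    field_simp
    ring
  · intro x t hx
    obtain ⟨y, rfl⟩ := Nat.exists_eq_add_of_le' hx
    have hdown : ∀ j, y + 1 + 2 * j + 2 = (y + 2 * j + 2) + 1 := fun j => by ring
    have hup : ∀ j, y + 1 + 1 + 2 * j + 2 = (y + 2 * j + 2) + 2 := fun j => by ring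
    rw [Nat.add_sub_cancel, Kab_eq_sum_scaledBessel α β (y + 1) (t + 1) (t + 1) le_rfl,
      Kab_eq_sum_scaledBessel α β (y + 1) t (t + 1) (by omega),
      Kab_eq_sum_scaledBessel α β (y + 1 + 1) t (t + 1) (by omega),
      Kab_eq_sum_scaledBessel α β y t (t + 1) (by omega)]
    simp only [hdown, hup, scaledBessel_succ_succ hα hβ hαβ, sum_add_distrib, ← mul_sum]
    ring
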